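/- Let G be a weak near-triangulation and let x be an external vertex of G. Then every bounded face of G−x is triangular. Moreover, every vertex y that is adjacent to x in G is an external vertex of G−x. -/

import Mathlib

open Set

/-- A plane graph: a finite simple graph whose vertices are points of the plane,
together with a plane embedding in which every edge is drawn as an arc (the range of an
injective path) joining its endpoints, two arcs meet only in common endpoints, and
no vertex lies on an arc other than at its endpoints. -/
structure PlaneGraph where
  verts : Set (ℝ × ℝ)
  finite_verts : verts.Finite
  Adj : (ℝ × ℝ) → (ℝ × ℝ) → Prop
  adj_symm : ∀ u v, Adj u v → Adj v u
  adj_irrefl : ∀ v, ¬ Adj v v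
  adj_mem : ∀ u v, Adj u v → u ∈ verts
  arc : (ℝ × ℝ) → (ℝ × ℝ) → Set (ℝ × ℝ)
  arc_symm : ∀ u v, arc u v = arc v u
  arc_path : ∀ u v, Adj u v → ∃ γ : Path u v, Function.Injective ⇑γ ∧ arc u v = Set.range ⇑γ
  arc_verts : ∀ u v, Adj u v → verts ∩ arc u v ⊆ {u, v}
  arc_inter : ∀ u v u' v', Adj u v → Adj u' v' → ({u, v} : Set (ℝ × ℝ)) ≠ {u', v'} →
    arc u v ∩ arc u' v' ⊆ ({u, v} : Set (ℝ × ℝ)) ∩ {u', v'}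

namespace PlaneGraph

/-- The plane subgraph induced on a set of vertices, with the inherited embedding. -/
def induce (G : PlaneGraph) (S : Set (ℝ × ℝ)) : PlaneGraph where
  verts := G.verts ∩ S
  finite_verts := G.finite_verts.subset inter_subset_left
  Adj u v := G.Adj u v ∧ u ∈ S ∧ v ∈ S
  adj_symm _ _ h := ⟨G.adj_symm _ _ h.1, h.2.2, h.2.1⟩
  adj_irrefl v h := G.adj_irrefl v h.1
  adj_mem _ _ h := ⟨G.adj_mem _ _ h.1, h.2.1⟩
  arc := G.arc
  arc_symm := G.arc_symm
  arc_path _ _ h := G.arc_path _ _ h.1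
  arc_verts _ _ h := fun _ hx => G.arc_verts _ _ h.1 ⟨hx.1.1, hx.2⟩
  arc_inter _ _ _ _ h h' hne := G.arc_inter _ _ _ _ h.1 h'.1 hne

/-- Deleting a set of vertices (together with all incident edges),
keeping the inherited embedding. -/
def delete (G : PlaneGraph) (X : Set (ℝ × ℝ)) : PlaneGraph := G.induce Xᶜ

/-- Deleting a single vertex. -/
def erase (G : PlaneGraph) (x : ℝ × ℝ) : PlaneGraph := G.delete {x}

/-- The point set of the plane drawing of `G`. -/
def drawing (G : PlaneGraph) : Set (ℝ × ℝ) :=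
  G.verts ∪ ⋃ (u) (v) (_ : G.Adj u v), G.arc u v

/-- The faces of `G`: connected components of the complement of the drawing. -/
def IsFace (G : PlaneGraph) (F : Set (ℝ × ℝ)) : Prop :=
  ∃ x, x ∉ G.drawing ∧ F = connectedComponentIn G.drawingᶜ x

/-- A vertex is external if it is incident to (i.e. lies on the boundary of)
an unbounded face. -/
def ExternalVertex (G : PlaneGraph) (v : ℝ × ℝ) : Prop :=
  v ∈ G.verts ∧ ∃ F, G.IsFace F ∧ ¬ Bornology.IsBounded F ∧ v ∈ closure F

/-- A triangle (cycle on three vertices) of `G`. -/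
def IsTriangle (G : PlaneGraph) (a b c : ℝ × ℝ) : Prop :=
  a ≠ b ∧ a ≠ c ∧ b ≠ c ∧ G.Adj a b ∧ G.Adj b c ∧ G.Adj a c

/-- `v` is contained in a triangle of `G`. -/
def InTriangle (G : PlaneGraph) (v : ℝ × ℝ) : Prop := ∃ b c, G.IsTriangle v b c

/-- The drawing of the closed curve formed by a triangle on `a`, `b`, `c`. -/
def triDrawing (G : PlaneGraph) (a b c : ℝ × ℝ) : Set (ℝ × ℝ) :=
  G.arc a b ∪ G.arc b c ∪ G.arc a c

/-- A face is triangular if its boundary is the drawing of a triangle of `G`. -/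
def IsTriangularFace (G : PlaneGraph) (F : Set (ℝ × ℝ)) : Prop :=
  ∃ a b c, G.IsTriangle a b c ∧ frontier F = G.triDrawing a b c

/-- The interior region of the closed curve drawn by a triangle: the union of the
bounded connected components of the complement of its drawing. -/
def triangleInterior (G : PlaneGraph) (a b c : ℝ × ℝ) : Set (ℝ × ℝ) :=
  {x | x ∉ G.triDrawing a b c ∧
    Bornology.IsBounded (connectedComponentIn (G.triDrawing a b c)ᶜ x)}

/-- A facial triangle: a triangle whose interior region is a face of `G`. -/
def IsFacialTriangle (G : PlaneGraph) (a b c : ℝ × ℝ) : Prop :=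
  G.IsTriangle a b c ∧ G.IsFace (G.triangleInterior a b c)

/-- A weak near-triangulation: every bounded face is triangular and every vertex
is contained in a triangle. -/
def IsWNT (G : PlaneGraph) : Prop :=
  (∀ F, G.IsFace F → Bornology.IsBounded F → G.IsTriangularFace F) ∧
  ∀ v ∈ G.verts, G.InTriangle v

/-- Reachability by walks in `G`. -/
def Reachable (G : PlaneGraph) (u v : ℝ × ℝ) : Prop := Relation.ReflTransGen G.Adj u v

/-- Connectedness of `G`. -/
def Connected (G : PlaneGraph) : Prop :=
  G.verts.Nonempty ∧ ∀ u ∈ G.verts, ∀ v ∈ G.verts, G.Reachable u v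

/-- A cutvertex: a vertex whose deletion separates two other vertices. -/
def IsCutvertex (G : PlaneGraph) (v : ℝ × ℝ) : Prop :=
  v ∈ G.verts ∧ ∃ a b, a ∈ G.verts ∧ b ∈ G.verts ∧ a ≠ v ∧ b ≠ v ∧
    G.Reachable a b ∧ ¬ (G.erase v).Reachable a b

/-- 2-connectivity: connected, on at least three vertices, with no cutvertex. -/
def TwoConnected (G : PlaneGraph) : Prop :=
  G.Connected ∧ 3 ≤ G.verts.ncard ∧ ∀ v, ¬ G.IsCutvertex v

/-- A near-triangulation: a 2-connected plane graph all of whose bounded faces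
are triangular. -/
def IsNearTriangulation (G : PlaneGraph) : Prop :=
  G.TwoConnected ∧ ∀ F, G.IsFace F → Bornology.IsBounded F → G.IsTriangularFace F

/-- A plane triangulation: a connected plane graph all of whose faces (including
the unbounded one) are triangular. -/
def IsTriangulation (G : PlaneGraph) : Prop :=
  G.Connected ∧ ∀ F, G.IsFace F → G.IsTriangularFace F

/-- A block of `G`, given by its vertex set `B`: a maximal set of vertices inducing
a connected subgraph without a cutvertex. -/
def IsBlock (G : PlaneGraph) (B : Set (ℝ × ℝ)) : Prop :=
  B ⊆ G.verts ∧ (G.induce B).Connected ∧ (∀ v, ¬ (G.induce B).IsCutvertex v) ∧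
  ∀ B', B ⊆ B' → B' ⊆ G.verts → (G.induce B').Connected →
    (∀ v, ¬ (G.induce B').IsCutvertex v) → B' = B

/-- A plane graph is outerplanar if all of its vertices are incident to the
unbounded face. -/
def IsOuterplanar (G : PlaneGraph) : Prop := ∀ v ∈ G.verts, G.ExternalVertex v

/-- A dominating set of `G`. -/
def IsDominatingSet (G : PlaneGraph) (D : Set (ℝ × ℝ)) : Prop :=
  D ⊆ G.verts ∧ ∀ v ∈ G.verts, v ∉ D → ∃ d ∈ D, G.Adj v d

/-- The domination number of `G`. -/
noncomputable def dominationNumber (G : PlaneGraph) : ℕ :=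
  sInf {n | ∃ D, G.IsDominatingSet D ∧ D.ncard = n}

/-- `u` is problematic in `G` if `G − u` is not a weak near-triangulation. -/
def Problematic (G : PlaneGraph) (u : ℝ × ℝ) : Prop := ¬ (G.erase u).IsWNT

/-- `x` is a `u`-bad vertex in `G`: a vertex of `G − u` not contained in a triangle
of `G − u`. -/
def IsBadFor (G : PlaneGraph) (u x : ℝ × ℝ) : Prop :=
  x ∈ G.verts ∧ x ≠ u ∧ ¬ (G.erase u).InTriangle x

end PlaneGraph

namespace PlaneGraph

variable (G : PlaneGraph) {u v x y : ℝ × ℝ}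

lemma adj_mem_right (h : G.Adj u v) : v ∈ G.verts := G.adj_mem v u (G.adj_symm u v h)

lemma left_mem_arc (h : G.Adj u v) : u ∈ G.arc u v := by
  obtain ⟨γ, -, hγ⟩ := G.arc_path u v h
  exact hγ ▸ ⟨0, γ.source⟩

lemma right_mem_arc (h : G.Adj u v) : v ∈ G.arc u v := by
  obtain ⟨γ, -, hγ⟩ := G.arc_path u v h
  exact hγ ▸ ⟨1, γ.target⟩

lemma isClosed_arc (h : G.Adj u v) : IsClosed (G.arc u v) := by
  obtain ⟨γ, -, hγ⟩ := G.arc_path u v h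
  exact hγ ▸ (isCompact_range γ.continuous).isClosed

lemma isClosed_drawing : IsClosed G.drawing := by
  have hD : G.drawing = G.verts ∪
      ⋃ p ∈ {p : (ℝ × ℝ) × (ℝ × ℝ) | G.Adj p.1 p.2}, G.arc p.1 p.2 := by
    ext z
    simp [drawing]
  have hfin : {p : (ℝ × ℝ) × (ℝ × ℝ) | G.Adj p.1 p.2}.Finite :=
    (G.finite_verts.prod G.finite_verts).subset fun p hp =>
      ⟨G.adj_mem _ _ hp, G.adj_mem_right hp⟩
  rw [hD]
  exact G.finite_verts.isClosed.union (hfin.isClosed_biUnion fun p hp => G.isClosed_arc hp)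

lemma arc_subset_drawing (h : G.Adj u v) : G.arc u v ⊆ G.drawing := fun z hz =>
  Or.inr (by simp only [mem_iUnion]; exact ⟨u, v, h, hz⟩)

/-- An arc without its second endpoint is connected. -/
lemma isPreconnected_arc_diff (h : G.Adj u v) : IsPreconnected (G.arc u v \ {v}) := by
  obtain ⟨γ, hinj, hγ⟩ := G.arc_path u v h
  have : G.arc u v \ {v} = γ '' Iio 1 := by
    ext z
    rw [hγ]
    constructor
    · rintro ⟨⟨t, rfl⟩, ht⟩
      refine ⟨t, lt_of_le_of_ne t.2.2 fun h1 => ht ?_, rfl⟩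
      rw [show t = 1 from Subtype.ext h1]
      exact γ.target
    · rintro ⟨t, ht, rfl⟩
      refine ⟨⟨t, rfl⟩, fun hv => ?_⟩
      exact (ne_of_lt ht) (hinj (hv.trans γ.target.symm))
  rw [this]
  exact isPreconnected_Iio.image _ γ.continuous.continuousOn

/-- The second endpoint of an arc is a limit of other points of the arc. -/
lemma right_mem_closure_arc_diff (h : G.Adj u v) : v ∈ closure (G.arc u v \ {v}) := by
  obtain ⟨γ, hinj, hγ⟩ := G.arc_path u v h
  have h1 : (1 : unitInterval) ∈ closure (Iio 1) := by
    rw [closure_Iio' ⟨0, zero_lt_one⟩]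
    exact self_mem_Iic
  have h2 := image_closure_subset_closure_image γ.continuous (mem_image_of_mem γ h1)
  rw [γ.target] at h2
  refine closure_mono ?_ h2
  rintro _ ⟨t, ht, rfl⟩
  refine ⟨hγ ▸ ⟨t, rfl⟩, fun hv => ?_⟩
  exact (ne_of_lt ht) (hinj (hv.trans γ.target.symm))

lemma erase_drawing_subset : (G.erase x).drawing ⊆ G.drawing := by
  rintro z (hz | hz)
  · exact Or.inl hz.1
  · simp only [mem_iUnion] at hz
    obtain ⟨u, v, h, hz⟩ := hz
    exact G.arc_subset_drawing h.1 hz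

lemma notMem_erase_drawing (hx : x ∈ G.verts) : x ∉ (G.erase x).drawing := by
  rintro (hz | hz)
  · exact hz.2 rfl
  · simp only [mem_iUnion] at hz
    obtain ⟨u, v, h, hz⟩ := hz
    rcases G.arc_verts u v h.1 ⟨hx, hz⟩ with rfl | rfl
    · exact h.2.1 rfl
    · exact h.2.2 rfl

lemma arc_diff_subset_compl_erase_drawing (h : G.Adj x y) :
    G.arc x y \ {y} ⊆ ((G.erase x).drawing)ᶜ := by
  rintro z ⟨hz, hzy⟩ hzD
  have hzx : z ≠ x := by
    rintro rfl
    exact G.notMem_erase_drawing (G.adj_mem _ _ h) hzD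
  have hz' : z ∉ ({x, y} : Set (ℝ × ℝ)) := by
    rintro (h1 | h1)
    · exact hzx h1
    · exact hzy h1
  rcases hzD with hv | hv
  · exact hz' (G.arc_verts x y h ⟨hv.1, hz⟩)
  · simp only [mem_iUnion] at hv
    obtain ⟨u, v, huv, hzuv⟩ := hv
    refine hz' (G.arc_inter x y u v h huv.1 (fun heq => ?_) ⟨hz, hzuv⟩).1
    have hx : x ∈ ({u, v} : Set (ℝ × ℝ)) := heq ▸ mem_insert x {y}
    rcases hx with rfl | rfl
    · exact huv.2.1 rfl
    · exact huv.2.2 rfl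

/-- The face of `G − x` containing the point `x`. -/
def erasedFace (x : ℝ × ℝ) : Set (ℝ × ℝ) := connectedComponentIn ((G.erase x).drawing)ᶜ x

lemma mem_erasedFace (hx : x ∈ G.verts) : x ∈ G.erasedFace x :=
  mem_connectedComponentIn (G.notMem_erase_drawing hx)

lemma isOpen_erasedFace : IsOpen (G.erasedFace x) :=
  (G.erase x).isClosed_drawing.isOpen_compl.connectedComponentIn

lemma arc_diff_subset_erasedFace (h : G.Adj x y) : G.arc x y \ {y} ⊆ G.erasedFace x := by
  refine (G.isPreconnected_arc_diff h).subset_connectedComponentIn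
    ⟨G.left_mem_arc h, ?_⟩ (G.arc_diff_subset_compl_erase_drawing h)
  rintro rfl
  exact G.adj_irrefl _ h

lemma drawing_subset_union_erasedFace (hx : x ∈ G.verts) :
    G.drawing ⊆ (G.erase x).drawing ∪ G.erasedFace x := by
  have key : ∀ y z, G.Adj x y → z ∈ G.arc x y →
      z ∈ (G.erase x).drawing ∪ G.erasedFace x := by
    intro y z h hz
    by_cases hzy : z = y
    · subst hzy
      refine Or.inl (Or.inl ⟨G.adj_mem_right h, ?_⟩)
      rintro rfl
      exact G.adj_irrefl _ h
    · exact Or.inr (G.arc_diff_subset_erasedFace h ⟨hz, hzy⟩)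
  rintro z (hz | hz)
  · by_cases hzx : z = x
    · subst hzx
      exact Or.inr (G.mem_erasedFace hx)
    · exact Or.inl (Or.inl ⟨hz, hzx⟩)
  · simp only [mem_iUnion] at hz
    obtain ⟨u, v, h, hz⟩ := hz
    by_cases hu : u = x
    · subst hu
      exact key v z h hz
    · by_cases hv : v = x
      · subst hv
        exact key u z (G.adj_symm _ _ h) (G.arc_symm u v ▸ hz)
      · exact Or.inl ((G.erase x).arc_subset_drawing (u := u) (v := v) ⟨h, hu, hv⟩ hz)

lemma not_isBounded_erasedFace (hx : G.ExternalVertex x) :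
    ¬ Bornology.IsBounded (G.erasedFace x) := by
  obtain ⟨hxv, F, ⟨z, -, rfl⟩, hF, hxF⟩ := hx
  intro hb
  refine hF (hb.subset ?_)
  have hpre : IsPreconnected (insert x (connectedComponentIn G.drawingᶜ z)) :=
    isPreconnected_connectedComponentIn.subset_closure (subset_insert _ _)
      (insert_subset hxF subset_closure)
  refine (subset_insert _ _).trans
    (hpre.subset_connectedComponentIn (mem_insert _ _) (insert_subset ?_ ?_))
  · exact G.notMem_erase_drawing hxv
  · exact (connectedComponentIn_subset _ _).trans
      (compl_subset_compl.2 G.erase_drawing_subset)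

lemma IsFace.disjoint_erasedFace {F : Set (ℝ × ℝ)} (hF : (G.erase x).IsFace F)
    (hne : F ≠ G.erasedFace x) : Disjoint F (G.erasedFace x) := by
  obtain ⟨z, -, rfl⟩ := hF
  rw [disjoint_left]
  intro w hw hw'
  exact hne ((connectedComponentIn_eq hw).trans (connectedComponentIn_eq hw').symm)

lemma IsFace.of_erase {F : Set (ℝ × ℝ)} (hx : x ∈ G.verts) (hF : (G.erase x).IsFace F)
    (hdisj : Disjoint F (G.erasedFace x)) : G.IsFace F := by
  obtain ⟨z, hz, rfl⟩ := hF
  have hsub : connectedComponentIn ((G.erase x).drawing)ᶜ z ⊆ G.drawingᶜ := by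
    intro w hw hwD
    rcases G.drawing_subset_union_erasedFace hx hwD with h | h
    · exact connectedComponentIn_subset _ _ hw h
    · exact disjoint_left.1 hdisj hw h
  have hzmem := mem_connectedComponentIn (F := ((G.erase x).drawing)ᶜ) hz
  exact ⟨z, hsub hzmem, Subset.antisymm
    (isPreconnected_connectedComponentIn.subset_connectedComponentIn hzmem hsub)
    (connectedComponentIn_mono z (compl_subset_compl.2 G.erase_drawing_subset))⟩

end PlaneGraph

open PlaneGraph in
/-- If `x` is an external vertex of a weak near-triangulation `G`, then every bounded
face of `G − x` is triangular, and every vertex adjacent to `x` in `G` is an external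
vertex of `G − x`. -/
theorem WNT_erase_external (G : PlaneGraph) (hG : G.IsWNT)
    (x : ℝ × ℝ) (hx : G.ExternalVertex x) :
    (∀ F, (G.erase x).IsFace F → Bornology.IsBounded F → (G.erase x).IsTriangularFace F) ∧
    ∀ y, G.Adj x y → (G.erase x).ExternalVertex y := by
  have hunb := G.not_isBounded_erasedFace hx
  refine ⟨fun F hF hb => ?_, fun y hxy => ?_⟩
  · have hdisj := IsFace.disjoint_erasedFace G hF (by rintro rfl; exact hunb hb)
    obtain ⟨a, b, c, ⟨hab, hac, hbc, Aab, Abc, Aac⟩, hfr⟩ :=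
      hG.1 F (IsFace.of_erase G hx.1 hF hdisj) hb
    have hxfr : x ∉ G.triDrawing a b c := fun h =>
      disjoint_left.1 (hdisj.closure_left G.isOpen_erasedFace)
        (frontier_subset_closure (hfr ▸ h)) (G.mem_erasedFace hx.1)
    have ha : a ≠ x := by
      rintro rfl
      exact hxfr (Or.inl (Or.inl (G.left_mem_arc Aab)))
    have hb : b ≠ x := by
      rintro rfl
      exact hxfr (Or.inl (Or.inl (G.right_mem_arc Aab)))
    have hc : c ≠ x := by
      rintro rfl
      exact hxfr (Or.inr (G.right_mem_arc Aac))
    exact ⟨a, b, c, ⟨hab, hac, hbc, ⟨Aab, ha, hb⟩, ⟨Abc, hb, hc⟩, ⟨Aac, ha, hc⟩⟩, hfr⟩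
  · refine ⟨⟨G.adj_mem_right hxy, ?_⟩, G.erasedFace x,
      ⟨x, G.notMem_erase_drawing hx.1, rfl⟩, hunb,
      closure_mono (G.arc_diff_subset_erasedFace hxy) (G.right_mem_closure_arc_diff hxy)⟩
    rintro rfl
    exact G.adj_irrefl _ hxy
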